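/- Key inequality L3 for negatively correlated channels: assume p11 ≤ p01, 0 ≤ β < 1, and β·(ℛ̲ + ℛ̄) ≤ ℛ̲, and set γ := ℛ̄/(1−β). Then for every t ∈ {1,…,T} and every belief vector ω ∈ [0,1]^N with p01 ≥ ω₁ ≥ ω₂ ≥ … ≥ ω_N ≥ p11, it holds that γ + W_t(ω₂, ω₃, …, ω_N, ω₁) ≥ W_t(ω₁, …, ω_N). -/

import Mathlib

open Finset

noncomputable section

/-- Belief update map `τ(ω) = ω·p11 + (1-ω)·p01`. -/
def tau (p01 p11 ω : ℝ) : ℝ := ω * p11 + (1 - ω) * p01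

/-- Expected one-step reward `R_m(ω; S)` with access cap `m`:
the expectation of `min(#available, m)` when each channel `i ∈ S` is
independently available with probability `ω i`. -/
def expReward {ι : Type*} [DecidableEq ι] (m : ℕ) (S : Finset ι) (ω : ι → ℝ) : ℝ :=
  ∑ A ∈ S.powerset,
    (∏ i ∈ A, ω i) * (∏ i ∈ S \ A, (1 - ω i)) * ((min A.card m : ℕ) : ℝ)

/-- The set of reward increments `R_m(1,x) − R_m(0,x)` over `x ∈ [lo,hi]^{k'}`
(on `k' + 1` channels). -/
def RdiffSet (lo hi : ℝ) (m k' : ℕ) : Set ℝ :=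
  { r : ℝ | ∃ x : Fin k' → ℝ, (∀ i, x i ∈ Set.Icc lo hi) ∧
      r = expReward m Finset.univ (Fin.cons 1 x) -
          expReward m Finset.univ (Fin.cons 0 x) }

/-- `ℛ̄`: maximal reward increment. -/
def Rbar (lo hi : ℝ) (m k' : ℕ) : ℝ := sSup (RdiffSet lo hi m k')

/-- `ℛ̲`: minimal reward increment. -/
def Rlow (lo hi : ℝ) (m k' : ℕ) : ℝ := sInf (RdiffSet lo hi m k')

/-- The first `k` channels out of `N` (the myopically sensed channels for a
descending-ordered belief vector). -/
def senseSet (N k : ℕ) : Finset (Fin N) := Finset.univ.filter (fun i => (i : ℕ) < k)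

/-- Positively correlated case successor belief vector: `c` copies of `p11`,
then `τ(ω_{k+1}), …, τ(ω_N)`, then `k - c` copies of `p01`. -/
def nextPos (p01 p11 : ℝ) {N : ℕ} (k : ℕ) (ω : Fin N → ℝ) (c : ℕ) : Fin N → ℝ :=
  fun i =>
    if h1 : (i : ℕ) < c then p11
    else if h2 : (i : ℕ) < c + (N - k) then
      tau p01 p11 (ω ⟨k + ((i : ℕ) - c), by have := i.isLt; omega⟩)
    else p01

/-- Negatively correlated case successor belief vector: `k - c` copies of `p01`,
then `τ(ω_N), τ(ω_{N-1}), …, τ(ω_{k+1})` (reversed), then `c` copies of `p11`. -/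
def nextNeg (p01 p11 : ℝ) {N : ℕ} (k : ℕ) (ω : Fin N → ℝ) (c : ℕ) : Fin N → ℝ :=
  fun i =>
    if h1 : (i : ℕ) < k - c then p01
    else if h2 : (i : ℕ) < (k - c) + (N - k) then
      tau p01 p11 (ω ⟨N - 1 - ((i : ℕ) - (k - c)), by have := i.isLt; omega⟩)
    else p11

/-- Myopic value functions for the positively correlated case, indexed by the
number `s` of remaining steps (so `W_t = Wpos (T - t)`). -/
def Wpos (p01 p11 β : ℝ) (N k m : ℕ) : ℕ → (Fin N → ℝ) → ℝ
  | 0, ω => expReward m (senseSet N k) ω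
  | s + 1, ω =>
    expReward m (senseSet N k) ω +
      β * ∑ A ∈ (senseSet N k).powerset,
        (∏ i ∈ A, ω i) * (∏ i ∈ senseSet N k \ A, (1 - ω i)) *
          Wpos p01 p11 β N k m s (nextPos p01 p11 k ω A.card)

/-- Myopic value functions for the negatively correlated case, indexed by the
number `s` of remaining steps (so `W_t = Wneg (T - t)`). -/
def Wneg (p01 p11 β : ℝ) (N k m : ℕ) : ℕ → (Fin N → ℝ) → ℝ
  | 0, ω => expReward m (senseSet N k) ω
  | s + 1, ω =>
    expReward m (senseSet N k) ω +
      β * ∑ A ∈ (senseSet N k).powerset,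
        (∏ i ∈ A, ω i) * (∏ i ∈ senseSet N k \ A, (1 - ω i)) *
          Wneg p01 p11 β N k m s (nextNeg p01 p11 k ω A.card)

/-- Optimal value functions, indexed by the number `s` of remaining steps
(so `V_t = Vopt (T - t)`). -/
def Vopt (p01 p11 β : ℝ) (N k m : ℕ) : ℕ → (Fin N → ℝ) → ℝ
  | 0, ω => sSup { r : ℝ | ∃ π : Finset (Fin N), π.card = k ∧ r = expReward m π ω }
  | s + 1, ω =>
    sSup { r : ℝ | ∃ π : Finset (Fin N), π.card = k ∧
      r = expReward m π ω +
        β * ∑ B ∈ π.powerset,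
          (∏ i ∈ B, ω i) * (∏ i ∈ π \ B, (1 - ω i)) *
            Vopt p01 p11 β N k m s
              (fun j => if j ∈ B then p11 else if j ∈ π then p01 else tau p01 p11 (ω j)) }

/-- The cyclic right shift `(ω_N, ω_1, …, ω_{N-1})`. -/
def cycR {N : ℕ} (ω : Fin N → ℝ) : Fin N → ℝ :=
  fun i =>
    if h : (i : ℕ) = 0 then ω ⟨N - 1, by have := i.isLt; omega⟩
    else ω ⟨(i : ℕ) - 1, by have := i.isLt; omega⟩

/-- The cyclic left shift `(ω_2, ω_3, …, ω_N, ω_1)`. -/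
def cycL {N : ℕ} (ω : Fin N → ℝ) : Fin N → ℝ :=
  fun i =>
    if h : (i : ℕ) + 1 < N then ω ⟨(i : ℕ) + 1, h⟩
    else ω ⟨0, by have := i.isLt; omega⟩

/-- The vector `(ω_1, …, ω_{j-1}, x, y, ω_{j+2}, …, ω_N)` (0-indexed: `x` at
position `j`, `y` at position `j+1`). -/
def swapAt {N : ℕ} (ω : Fin N → ℝ) (j : ℕ) (x y : ℝ) : Fin N → ℝ :=
  fun i => if (i : ℕ) = j then x else if (i : ℕ) = j + 1 then y else ω i

end

/-- The expectation of `f` at the number of successes of independent Bernoulli trials whose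
success probabilities are listed in `L`. -/
noncomputable def countExp : List ℝ → (ℕ → ℝ) → ℝ
  | [], f => f 0
  | x :: L, f => x * countExp L (fun c => f (c + 1)) + (1 - x) * countExp L f

theorem countExp_perm {L L' : List ℝ} (h : L.Perm L') (f : ℕ → ℝ) :
    countExp L f = countExp L' f := by
  induction h generalizing f with
  | nil => rfl
  | cons x _ ih => simp only [countExp, ih]
  | swap x y l => simp only [countExp]; ring
  | trans _ _ ih1 ih2 => rw [ih1, ih2]

theorem countExp_linear (L : List ℝ) (u v : ℝ) (f g : ℕ → ℝ) :
    countExp L (fun c => u * f c + v * g c) = u * countExp L f + v * countExp L g := by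
  induction L generalizing f g with
  | nil => rfl
  | cons x L ih => simp only [countExp, ih]; ring

theorem countExp_const (L : List ℝ) (u : ℝ) : countExp L (fun _ => u) = u := by
  induction L with
  | nil => rfl
  | cons x L ih => simp only [countExp, ih]; ring

theorem countExp_mono {L : List ℝ} (hL : ∀ x ∈ L, x ∈ Set.Icc (0 : ℝ) 1) {f g : ℕ → ℝ}
    (h : ∀ c ≤ L.length, f c ≤ g c) : countExp L f ≤ countExp L g := by
  induction L generalizing f g with
  | nil => exact h 0 le_rfl
  | cons x L ih =>
    have hx := hL x (by simp)
    have hL' : ∀ y ∈ L, y ∈ Set.Icc (0 : ℝ) 1 := fun y hy => hL y (by simp [hy])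
    have e1 := ih hL' (f := fun c => f (c + 1)) (g := fun c => g (c + 1))
      (fun c hc => h _ (by simpa using hc))
    have e2 := ih hL' (f := f) (g := g) (fun c hc => h _ (by simp; omega))
    simp only [countExp]
    exact add_le_add (mul_le_mul_of_nonneg_left e1 hx.1)
      (mul_le_mul_of_nonneg_left e2 (sub_nonneg.2 hx.2))

theorem countExp_congr {L : List ℝ} {f g : ℕ → ℝ}
    (h : ∀ c ≤ L.length, f c = g c) : countExp L f = countExp L g := by
  induction L generalizing f g with
  | nil => exact h 0 le_rfl
  | cons x L ih =>
    simp only [countExp]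
    rw [ih (f := fun c => f (c + 1)) (g := fun c => g (c + 1))
      (fun c hc => h _ (by simpa using hc)), ih (f := f) (g := g) (fun c hc => h _ (by simp; omega))]

theorem countExp_le_add {L : List ℝ} (hL : ∀ x ∈ L, x ∈ Set.Icc (0 : ℝ) 1) {f g d : ℕ → ℝ}
    {u v : ℝ} (h : ∀ c ≤ L.length, f c ≤ g c + u * d c + v) :
    countExp L f ≤ countExp L g + u * countExp L d + v := by
  have e := countExp_mono hL h
  have e' : (fun c => g c + u * d c + v) =
      fun c => 1 * (fun c => 1 * g c + u * d c) c + v * (fun _ => (1 : ℝ)) c := by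
    funext c; ring
  rw [e', countExp_linear, countExp_linear, countExp_const] at e
  linarith

theorem countExp_convex_entry (P Q : List ℝ) (u x y : ℝ) (f : ℕ → ℝ) :
    countExp (P ++ (u * x + (1 - u) * y) :: Q) f =
      u * countExp (P ++ x :: Q) f + (1 - u) * countExp (P ++ y :: Q) f := by
  simp only [fun z => countExp_perm (L := P ++ z :: Q) List.perm_middle f, countExp]
  ring

/-- The subset expansion of `countExp`. -/
theorem sum_powerset_eq_countExp {ι : Type*} [DecidableEq ι] (l : List ι) (hl : l.Nodup)
    (ω : ι → ℝ) (f : ℕ → ℝ) :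
    ∑ A ∈ l.toFinset.powerset, (∏ i ∈ A, ω i) * (∏ i ∈ l.toFinset \ A, (1 - ω i)) * f A.card =
      countExp (l.map ω) f := by
  induction l generalizing f with
  | nil => simp [countExp]
  | cons a l ih =>
    obtain ⟨ha, hl⟩ := List.nodup_cons.1 hl
    have ha' : a ∉ l.toFinset := by simpa using ha
    rw [List.toFinset_cons, Finset.sum_powerset_insert ha', List.map_cons, countExp, ← ih hl,
      ← ih hl, add_comm, Finset.mul_sum, Finset.mul_sum]
    congr 1
    · refine Finset.sum_congr rfl fun A hA => ?_
      have haA : a ∉ A := fun h => ha' (Finset.mem_powerset.1 hA h)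
      rw [Finset.prod_insert haA, Finset.card_insert_of_notMem haA,
        Finset.insert_sdiff_insert, Finset.sdiff_insert_of_notMem ha']
      ring
    · refine Finset.sum_congr rfl fun A hA => ?_
      have haA : a ∉ A := fun h => ha' (Finset.mem_powerset.1 hA h)
      rw [Finset.insert_sdiff_of_notMem _ haA, Finset.prod_insert (by simp [ha])]
      ring

theorem senseSet_eq_toFinset (N k : ℕ) :
    senseSet N k = ((List.finRange N).take k).toFinset := by
  ext i
  simp only [senseSet, Finset.mem_filter, Finset.mem_univ, true_and, List.mem_toFinset,
    List.mem_take_iff_getElem, List.getElem_finRange, List.length_finRange]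
  constructor
  · exact fun h => ⟨i, by have := i.isLt; omega, rfl⟩
  · rintro ⟨j, hj, rfl⟩
    simp only [Fin.val_cast]
    omega

theorem sum_senseSet_eq_countExp {N : ℕ} (k : ℕ) (ω : Fin N → ℝ) (f : ℕ → ℝ) :
    ∑ A ∈ (senseSet N k).powerset,
        (∏ i ∈ A, ω i) * (∏ i ∈ senseSet N k \ A, (1 - ω i)) * f A.card =
      countExp ((List.ofFn ω).take k) f := by
  rw [senseSet_eq_toFinset, sum_powerset_eq_countExp _
    ((List.nodup_finRange N).sublist (List.take_sublist _ _)), List.map_take, List.ofFn_eq_map]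

theorem expReward_univ {n m : ℕ} (ω : Fin n → ℝ) :
    expReward m Finset.univ ω = countExp (List.ofFn ω) (fun c => ((min c m : ℕ) : ℝ)) := by
  rw [List.ofFn_eq_map, ← sum_powerset_eq_countExp _ (List.nodup_finRange n),
    List.toFinset_finRange]
  rfl

/-- The expected gain from one more available channel. -/
noncomputable def rewardGain (m : ℕ) (L : List ℝ) : ℝ :=
  countExp L (fun c => ((min (c + 1) m : ℕ) : ℝ) - ((min c m : ℕ) : ℝ))

theorem rewardGain_mem_Icc (m : ℕ) {L : List ℝ} (hL : ∀ x ∈ L, x ∈ Set.Icc (0 : ℝ) 1) :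
    rewardGain m L ∈ Set.Icc (0 : ℝ) 1 := by
  constructor
  · rw [← countExp_const L 0]
    refine countExp_mono hL fun c _ => sub_nonneg.2 ?_
    exact_mod_cast (by omega : min c m ≤ min (c + 1) m)
  · rw [← countExp_const L 1]
    refine countExp_mono hL fun c _ => ?_
    rw [sub_le_iff_le_add]
    exact_mod_cast (by omega : min (c + 1) m ≤ 1 + min c m)

theorem mem_RdiffSet_iff {lo hi : ℝ} {m n : ℕ} {r : ℝ} :
    r ∈ RdiffSet lo hi m n ↔
      ∃ L : List ℝ, L.length = n ∧ (∀ x ∈ L, x ∈ Set.Icc lo hi) ∧ r = rewardGain m L := by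
  have key (x : Fin n → ℝ) : expReward m Finset.univ (Fin.cons 1 x : Fin (n + 1) → ℝ) -
      expReward m Finset.univ (Fin.cons 0 x : Fin (n + 1) → ℝ) = rewardGain m (List.ofFn x) := by
    have e : (fun c : ℕ => ((min (c + 1) m : ℕ) : ℝ) - ((min c m : ℕ) : ℝ)) = fun c =>
        1 * (fun c : ℕ => ((min (c + 1) m : ℕ) : ℝ)) c
          + (-1) * (fun c : ℕ => ((min c m : ℕ) : ℝ)) c := by
      funext c; ring
    rw [expReward_univ, expReward_univ, List.ofFn_cons, List.ofFn_cons, rewardGain, e,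
      countExp_linear]
    simp only [countExp]
    ring
  constructor
  · rintro ⟨x, hx, rfl⟩
    exact ⟨List.ofFn x, by simp, by simpa [List.mem_ofFn] using hx, key x⟩
  · rintro ⟨L, rfl, hL, rfl⟩
    exact ⟨L.get, fun i => hL _ (L.get_mem i), by rw [key, List.ofFn_get]⟩

theorem rewardGain_bounds {lo hi : ℝ} (h0 : 0 ≤ lo) (h1 : hi ≤ 1) {m : ℕ} {L : List ℝ}
    (hL : ∀ x ∈ L, x ∈ Set.Icc lo hi) :
    Rlow lo hi m L.length ≤ rewardGain m L ∧ rewardGain m L ≤ Rbar lo hi m L.length := by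
  have hmem : rewardGain m L ∈ RdiffSet lo hi m L.length := mem_RdiffSet_iff.2 ⟨L, rfl, hL, rfl⟩
  have hb : ∀ r ∈ RdiffSet lo hi m L.length, r ∈ Set.Icc (0 : ℝ) 1 := by
    intro r hr
    obtain ⟨L', -, hL', rfl⟩ := mem_RdiffSet_iff.1 hr
    exact rewardGain_mem_Icc m fun x hx => ⟨h0.trans (hL' x hx).1, (hL' x hx).2.trans h1⟩
  exact ⟨csInf_le ⟨0, fun r hr => (hb r hr).1⟩ hmem, le_csSup ⟨1, fun r hr => (hb r hr).2⟩ hmem⟩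

theorem Rbar_nonneg {lo hi : ℝ} (h0 : 0 ≤ lo) (h1 : hi ≤ 1) (m n : ℕ) : 0 ≤ Rbar lo hi m n := by
  refine Real.sSup_nonneg fun r hr => ?_
  obtain ⟨L, -, hL, rfl⟩ := mem_RdiffSet_iff.1 hr
  exact (rewardGain_mem_Icc m fun x hx => ⟨h0.trans (hL x hx).1, (hL x hx).2.trans h1⟩).1

/-- The myopic value function for negatively correlated channels as a function of a list of
beliefs, with `s` reward-collecting steps. -/
noncomputable def listVal (p01 p11 β : ℝ) (k m : ℕ) : ℕ → List ℝ → ℝ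
  | 0, _ => 0
  | s + 1, L => countExp (L.take k) fun c => ((min c m : ℕ) : ℝ) + β *
      listVal p01 p11 β k m s (List.replicate (k - c) p01 ++
        (((L.drop k).map (tau p01 p11)).reverse ++ List.replicate c p11))

section ListVal

variable {p01 p11 β : ℝ} {k m : ℕ}

theorem listVal_succ_append (s : ℕ) {S : List ℝ} (hS : S.length = k) (U : List ℝ) :
    listVal p01 p11 β k m (s + 1) (S ++ U) =
      countExp S fun c => ((min c m : ℕ) : ℝ) + β *
        listVal p01 p11 β k m s (List.replicate (k - c) p01 ++
          ((U.map (tau p01 p11)).reverse ++ List.replicate c p11)) := by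
  subst hS
  simp [listVal]

theorem listVal_perm_append (s : ℕ) {S S' : List ℝ} (h : S.Perm S') (hS : S.length = k)
    (U : List ℝ) :
    listVal p01 p11 β k m s (S ++ U) = listVal p01 p11 β k m s (S' ++ U) := by
  cases s with
  | zero => rfl
  | succ s =>
    rw [listVal_succ_append s hS, listVal_succ_append s (h.length_eq ▸ hS), countExp_perm h]

theorem listVal_perm_of_length_le (s : ℕ) {L L' : List ℝ} (h : L.Perm L') (hL : L.length ≤ k) :
    listVal p01 p11 β k m s L = listVal p01 p11 β k m s L' := by
  cases s with
  | zero => rfl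
  | succ s =>
    have hL' : L'.length ≤ k := h.length_eq ▸ hL
    simp only [listVal, List.take_of_length_le hL, List.take_of_length_le hL',
      List.drop_of_length_le hL, List.drop_of_length_le hL', countExp_perm h]

theorem tau_convex (p01 p11 u x y : ℝ) :
    tau p01 p11 (u * x + (1 - u) * y) = u * tau p01 p11 x + (1 - u) * tau p01 p11 y := by
  simp only [tau]; ring

theorem listVal_convex_entry (s : ℕ) (P Q : List ℝ) (u x y : ℝ) :
    listVal p01 p11 β k m s (P ++ (u * x + (1 - u) * y) :: Q) =
      u * listVal p01 p11 β k m s (P ++ x :: Q) +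
        (1 - u) * listVal p01 p11 β k m s (P ++ y :: Q) := by
  induction s generalizing P Q u x y with
  | zero => simp [listVal]
  | succ s ih =>
    rcases lt_or_ge P.length k with h | h
    · obtain ⟨j, hj⟩ : ∃ j, k - P.length = j + 1 := ⟨k - P.length - 1, by omega⟩
      simp only [listVal, List.take_append, List.drop_append, List.take_of_length_le h.le,
        List.drop_of_length_le h.le, hj, List.take_succ_cons, List.drop_succ_cons]
      rw [countExp_convex_entry]
    · obtain ⟨P₁, P₂, rfl, hP⟩ : ∃ P₁ P₂, P = P₁ ++ P₂ ∧ P₁.length = k :=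
        ⟨P.take k, P.drop k, by simp, by simp [h]⟩
      simp only [List.append_assoc]
      rw [listVal_succ_append s hP, listVal_succ_append s hP, listVal_succ_append s hP,
        ← countExp_linear]
      congr 1
      funext c
      have e := ih (List.replicate (k - c) p01 ++ (Q.map (tau p01 p11)).reverse)
        ((P₂.map (tau p01 p11)).reverse ++ List.replicate c p11) u (tau p01 p11 x)
        (tau p01 p11 y)
      simp only [List.map_append, List.map_cons, List.reverse_append, List.reverse_cons,
        List.append_assoc, List.cons_append, List.nil_append, tau_convex] at e ⊢
      rw [e]; ring

theorem tau_mem_Icc (hp : p11 ≤ p01) {x : ℝ} (hx : x ∈ Set.Icc (0 : ℝ) 1) :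
    tau p01 p11 x ∈ Set.Icc p11 p01 := by
  obtain ⟨h0, h1⟩ := hx
  constructor <;> simp only [tau] <;> nlinarith

theorem tau_antitone (hp : p11 ≤ p01) {x y : ℝ} (h : y ≤ x) : tau p01 p11 x ≤ tau p01 p11 y := by
  simp only [tau]; nlinarith

/-- Exchanging adjacent entries of the belief list so that the larger comes first helps. -/
def SwapMono (p01 p11 : ℝ) (V : List ℝ → ℝ) : Prop :=
  ∀ (P Q : List ℝ) (x y : ℝ), (∀ z ∈ P ++ x :: y :: Q, z ∈ Set.Icc p11 p01) → y ≤ x →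
    V (P ++ y :: x :: Q) ≤ V (P ++ x :: y :: Q)

/-- A cyclic shift of the belief list changes the value by at most `γ`. -/
def ShiftBound (p01 p11 γ : ℝ) (V : List ℝ → ℝ) : Prop :=
  ∀ (x : ℝ) (U : List ℝ), (∀ z ∈ x :: U, z ∈ Set.Icc p11 p01) →
    V (x :: U) ≤ V (U ++ [x]) + γ ∧ V (U ++ [x]) ≤ V (x :: U) + γ

theorem SwapMono.move_max {V : List ℝ → ℝ} (hV : SwapMono p01 p11 V) (hp : p11 ≤ p01)
    (P M Q : List ℝ) (h : ∀ z ∈ P ++ (M ++ Q), z ∈ Set.Icc p11 p01) :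
    V (P ++ (M ++ p01 :: Q)) ≤ V (P ++ p01 :: (M ++ Q)) := by
  induction M generalizing P with
  | nil => simp
  | cons a M ih =>
    have e1 := ih (P ++ [a]) (by simpa using h)
    have e2 := hV P (M ++ Q) p01 a (by
      intro z hz
      simp only [List.mem_append, List.mem_cons] at hz h
      rcases hz with hz | rfl | hz
      · exact h z (.inl hz)
      · exact ⟨hp, le_rfl⟩
      · exact h z (.inr (by tauto))) (h a (by simp)).2
    simp only [List.append_assoc, List.cons_append, List.nil_append] at e1 ⊢
    exact e1.trans e2

theorem SwapMono.move_min {V : List ℝ → ℝ} (hV : SwapMono p01 p11 V) (hp : p11 ≤ p01)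
    (P M Q : List ℝ) (h : ∀ z ∈ P ++ (M ++ Q), z ∈ Set.Icc p11 p01) :
    V (P ++ p11 :: (M ++ Q)) ≤ V (P ++ (M ++ p11 :: Q)) := by
  induction M generalizing P with
  | nil => simp
  | cons a M ih =>
    have e1 := ih (P ++ [a]) (by simpa using h)
    have e2 := hV P (M ++ Q) a p11 (by
      intro z hz
      simp only [List.mem_append, List.mem_cons] at hz h
      rcases hz with hz | rfl | rfl | hz
      · exact h z (.inl hz)
      · exact h z (.inr (by tauto))
      · exact ⟨le_rfl, hp⟩
      · exact h z (.inr (by tauto))) (h a (by simp)).1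
    simp only [List.append_assoc, List.cons_append, List.nil_append] at e1 ⊢
    exact e2.trans e1

theorem ShiftBound.move_max {V : List ℝ → ℝ} {γ : ℝ} (hS : ShiftBound p01 p11 γ V)
    (hV : SwapMono p01 p11 V) (hp : p11 ≤ p01)
    (P M Q : List ℝ) (h : ∀ z ∈ P ++ (M ++ Q), z ∈ Set.Icc p11 p01) :
    V (P ++ p01 :: (M ++ Q)) ≤ V (P ++ (M ++ p01 :: Q)) + γ := by
  have e1 := hV.move_max hp [] P (M ++ Q) (by simpa using h)
  have e2 := (hS p01 (P ++ (M ++ Q)) (by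
    simp only [List.mem_cons, forall_eq_or_imp]
    exact ⟨⟨hp, le_rfl⟩, h⟩)).1
  have e3 := hV.move_max hp (P ++ M) Q [] (by simpa using h)
  simp only [List.append_assoc, List.nil_append, List.append_nil] at e1 e2 e3
  linarith

theorem ShiftBound.move_min {V : List ℝ → ℝ} {γ : ℝ} (hS : ShiftBound p01 p11 γ V)
    (hV : SwapMono p01 p11 V) (hp : p11 ≤ p01)
    (P M Q : List ℝ) (h : ∀ z ∈ P ++ (M ++ Q), z ∈ Set.Icc p11 p01) :
    V (P ++ (M ++ p11 :: Q)) ≤ V (P ++ p11 :: (M ++ Q)) + γ := by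
  have e1 := hV.move_min hp [] P (M ++ Q) (by simpa using h)
  have e2 := (hS p11 (P ++ (M ++ Q)) (by
    simp only [List.mem_cons, forall_eq_or_imp]
    exact ⟨⟨le_rfl, hp⟩, h⟩)).2
  have e3 := hV.move_min hp (P ++ M) Q [] (by simpa using h)
  simp only [List.append_assoc, List.nil_append, List.append_nil] at e1 e2 e3
  linarith

theorem mem_Icc_of_mem_successor (h0 : 0 ≤ p11) (h1 : p01 ≤ 1) (hp : p11 ≤ p01) (i j : ℕ)
    {U : List ℝ} (hU : ∀ z ∈ U, z ∈ Set.Icc p11 p01) :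
    ∀ z ∈ List.replicate i p01 ++ ((U.map (tau p01 p11)).reverse ++ List.replicate j p11),
      z ∈ Set.Icc p11 p01 := by
  intro z hz
  simp only [List.mem_append, List.mem_replicate, List.mem_reverse, List.mem_map] at hz
  rcases hz with ⟨-, rfl⟩ | ⟨w, hw, rfl⟩ | ⟨-, rfl⟩
  · exact ⟨hp, le_rfl⟩
  · exact tau_mem_Icc hp ⟨h0.trans (hU w hw).1, (hU w hw).2.trans h1⟩
  · exact ⟨le_rfl, hp⟩

theorem swapMono_listVal_succ {γ : ℝ} (h0 : 0 ≤ p11) (h1 : p01 ≤ 1) (hp : p11 ≤ p01)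
    (hβ0 : 0 ≤ β) (hcond : β * γ ≤ Rlow p11 p01 m (k - 1)) {s : ℕ}
    (hV : SwapMono p01 p11 (listVal p01 p11 β k m s))
    (hS : ShiftBound p01 p11 γ (listVal p01 p11 β k m s)) :
    SwapMono p01 p11 (listVal p01 p11 β k m (s + 1)) := by
  intro P Q x y h hxy
  have h01 : ∀ z ∈ P ++ x :: y :: Q, z ∈ Set.Icc (0 : ℝ) 1 :=
    fun z hz => ⟨h0.trans (h z hz).1, (h z hz).2.trans h1⟩
  rcases lt_trichotomy (P.length + 1) k with hk | hk | hk
  · refine le_of_eq ?_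
    obtain ⟨j, hj⟩ : ∃ j, k - P.length = j + 1 + 1 := ⟨k - P.length - 2, by omega⟩
    have hPk : P.length ≤ k := by omega
    simp only [listVal, List.take_append, List.drop_append, List.take_of_length_le hPk,
      List.drop_of_length_le hPk, hj, List.take_succ_cons, List.drop_succ_cons]
    exact countExp_perm ((List.Perm.swap x y _).append_left P) _
  · have hP : ∀ z ∈ P, z ∈ Set.Icc (0 : ℝ) 1 := fun z hz => h01 z (by simp [hz])
    have hlen (z : ℝ) : (P ++ [z]).length = k := by simpa using hk
    have hsplit (z w : ℝ) : P ++ z :: w :: Q = (P ++ [z]) ++ w :: Q := by simp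
    set σ := (Q.map (tau p01 p11)).reverse with hσ
    set F : ℝ → ℕ → ℝ := fun v c => ((min c m : ℕ) : ℝ) + β *
        listVal p01 p11 β k m s (List.replicate (k - c) p01 ++
          (σ ++ v :: List.replicate c p11)) with hF
    have hval (z w : ℝ) : listVal p01 p11 β k m (s + 1) (P ++ z :: w :: Q) =
        z * (w * countExp P (fun c => F p11 (c + 1)) +
            (1 - w) * countExp P (fun c => F p01 (c + 1))) +
          (1 - z) * (w * countExp P (F p11) + (1 - w) * countExp P (F p01)) := by
      rw [hsplit, listVal_succ_append s (hlen z),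
        countExp_perm (List.perm_append_comm : (P ++ [z]).Perm ([z] ++ P)), List.singleton_append,
        countExp, ← countExp_linear P w (1 - w), ← countExp_linear P w (1 - w)]
      have e (c : ℕ) := listVal_convex_entry (p01 := p01) (p11 := p11) (β := β) (k := k) (m := m) s
        (List.replicate (k - c) p01 ++ σ) (List.replicate c p11) w p11 p01
      simp only [List.append_assoc] at e
      simp only [List.map_cons, List.reverse_cons, List.append_assoc, List.cons_append,
        List.nil_append, ← hσ, hF]
      congr 3 <;> funext c <;> simp only [tau, e] <;> ring
    have hgain := (rewardGain_bounds h0 h1 (m := m) (L := P) (fun z hz => h z (by simp [hz]))).1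
    have hPl : P.length = k - 1 := by omega
    rw [hPl] at hgain
    have hcmp : countExp P (F p11) ≤ countExp P (fun c => F p01 (c + 1)) +
        (-1) * rewardGain m P + β * γ := by
      refine countExp_le_add hP fun c hc => ?_
      have e := hS.move_max hV hp (List.replicate (k - (c + 1)) p01) σ (List.replicate (c + 1) p11)
        (mem_Icc_of_mem_successor h0 h1 hp _ _ fun z hz => h z (by simp [hz]))
      have hc' : k - c = k - (c + 1) + 1 := by omega
      simp only [hF, hc', List.replicate_succ' (n := k - (c + 1)), List.append_assoc,
        List.replicate_succ (n := c), List.cons_append, List.nil_append] at e ⊢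
      have := mul_le_mul_of_nonneg_left e hβ0
      linarith
    rw [hval, hval, ← sub_nonneg]
    have : 0 ≤ (x - y) * (countExp P (fun c => F p01 (c + 1)) - countExp P (F p11)) :=
      mul_nonneg (sub_nonneg.2 hxy) (by linarith)
    linarith
  · obtain ⟨P₁, P₂, rfl, hP⟩ : ∃ P₁ P₂, P = P₁ ++ P₂ ∧ P₁.length = k :=
      ⟨P.take k, P.drop k, by simp, by simp; omega⟩
    simp only [List.append_assoc] at h h01 ⊢
    rw [listVal_succ_append s hP, listVal_succ_append s hP]
    refine countExp_mono (fun z hz => h01 z (by simp [hz])) fun c _ => ?_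
    have hmem := mem_Icc_of_mem_successor h0 h1 hp (k - c) c (U := P₂ ++ x :: y :: Q)
      (fun z hz => h z (List.mem_append_right _ hz))
    have e := hV (List.replicate (k - c) p01 ++ (Q.map (tau p01 p11)).reverse)
      ((P₂.map (tau p01 p11)).reverse ++ List.replicate c p11) (tau p01 p11 y) (tau p01 p11 x)
      (by simpa using hmem) (tau_antitone hp hxy)
    simp only [List.map_append, List.map_cons, List.reverse_append, List.reverse_cons,
      List.append_assoc, List.cons_append, List.nil_append] at e ⊢
    gcongr

theorem shiftBound_listVal_succ {γ : ℝ} (h0 : 0 ≤ p11) (h1 : p01 ≤ 1) (hp : p11 ≤ p01)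
    (hk : 1 ≤ k) (hβ0 : 0 ≤ β) (hγ : Rbar p11 p01 m (k - 1) + β * γ ≤ γ) (hγ0 : 0 ≤ γ) {s : ℕ}
    (hV : SwapMono p01 p11 (listVal p01 p11 β k m s))
    (hS : ShiftBound p01 p11 γ (listVal p01 p11 β k m s)) :
    ShiftBound p01 p11 γ (listVal p01 p11 β k m (s + 1)) := by
  intro x U h
  rcases lt_or_ge U.length k with hUk | hUk
  · rw [listVal_perm_of_length_le (s + 1) (List.perm_append_singleton x U) (by simpa using hUk)]
    constructor <;> linarith
  obtain ⟨S, y, Q, rfl, hlen⟩ : ∃ S y Q, U = S ++ y :: Q ∧ S.length + 1 = k := by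
    refine ⟨U.take (k - 1), U[k - 1], U.drop k, ?_, by simp; omega⟩
    have := List.drop_eq_getElem_cons (l := U) (i := k - 1) (by omega)
    rw [Nat.sub_add_cancel hk] at this
    rw [← this, List.take_append_drop]
  have h01 : ∀ z ∈ x :: (S ++ y :: Q), z ∈ Set.Icc (0 : ℝ) 1 :=
    fun z hz => ⟨h0.trans (h z hz).1, (h z hz).2.trans h1⟩
  have hx := h01 x (by simp)
  have hy := h01 y (by simp)
  have hS01 : ∀ z ∈ S, z ∈ Set.Icc (0 : ℝ) 1 := fun z hz => h01 z (by simp [hz])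
  set σ := (Q.map (tau p01 p11)).reverse with hσ
  set W := listVal p01 p11 β k m s with hW
  set F : ℝ → ℕ → ℝ := fun v c => ((min c m : ℕ) : ℝ) + β *
      W (List.replicate (k - c) p01 ++ (σ ++ v :: List.replicate c p11)) with hF
  set G : ℝ → ℕ → ℝ := fun v c => ((min c m : ℕ) : ℝ) + β *
      W (List.replicate (k - c) p01 ++ v :: (σ ++ List.replicate c p11)) with hG
  have hvalF : listVal p01 p11 β k m (s + 1) (x :: (S ++ y :: Q)) =
      x * (y * countExp S (fun c => F p11 (c + 1)) +
          (1 - y) * countExp S (fun c => F p01 (c + 1))) +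
        (1 - x) * (y * countExp S (F p11) + (1 - y) * countExp S (F p01)) := by
    rw [← List.cons_append, listVal_succ_append s (by simpa using hlen), countExp,
      ← countExp_linear S y (1 - y), ← countExp_linear S y (1 - y)]
    have e (c : ℕ) := listVal_convex_entry (p01 := p01) (p11 := p11) (β := β) (k := k) (m := m) s
      (List.replicate (k - c) p01 ++ σ) (List.replicate c p11) y p11 p01
    simp only [List.append_assoc] at e
    simp only [List.map_cons, List.reverse_cons, List.append_assoc, List.cons_append,
      List.nil_append, ← hσ, hF]
    congr 3 <;> funext c <;> simp only [tau, e, hW] <;> ring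
  have hvalG : listVal p01 p11 β k m (s + 1) ((S ++ y :: Q) ++ [x]) =
      y * (x * countExp S (fun c => G p11 (c + 1)) +
          (1 - x) * countExp S (fun c => G p01 (c + 1))) +
        (1 - y) * (x * countExp S (G p11) + (1 - x) * countExp S (G p01)) := by
    have hsplit : (S ++ y :: Q) ++ [x] = (S ++ [y]) ++ (Q ++ [x]) := by simp
    rw [hsplit, listVal_succ_append s (by simpa using hlen),
      countExp_perm (List.perm_append_comm : (S ++ [y]).Perm ([y] ++ S)), List.singleton_append,
      countExp, ← countExp_linear S x (1 - x), ← countExp_linear S x (1 - x)]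
    have e (c : ℕ) := listVal_convex_entry (p01 := p01) (p11 := p11) (β := β) (k := k) (m := m) s
      (List.replicate (k - c) p01) (σ ++ List.replicate c p11) x p11 p01
    simp only [List.map_append, List.map_cons, List.map_nil, List.reverse_append,
      List.reverse_cons, List.reverse_nil, List.cons_append, List.nil_append, ← hσ, hG]
    congr 3 <;> funext c <;> simp only [tau, e, hW] <;> ring
  have hmem (i j : ℕ) : ∀ z ∈ List.replicate i p01 ++ (σ ++ List.replicate j p11),
      z ∈ Set.Icc p11 p01 :=
    mem_Icc_of_mem_successor h0 h1 hp i j fun z hz => h z (by simp [hz])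
  have hSl : S.length = k - 1 := by omega
  have hgain0 := (rewardGain_mem_Icc m hS01).1
  have hgain1 := (rewardGain_bounds h0 h1 (m := m) (L := S) (fun z hz => h z (by simp [hz]))).2
  rw [hSl] at hgain1
  have hβγ : 0 ≤ β * γ := mul_nonneg hβ0 hγ0
  have b11 : countExp S (fun c => G p11 (c + 1)) ≤ countExp S (fun c => F p11 (c + 1)) ∧
      countExp S (fun c => F p11 (c + 1)) ≤
        countExp S (fun c => G p11 (c + 1)) + 0 * rewardGain m S + β * γ := by
    refine ⟨countExp_mono hS01 fun c _ => ?_, countExp_le_add hS01 fun c _ => ?_⟩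
    · have e := mul_le_mul_of_nonneg_left (hV.move_min hp _ _ _ (hmem (k - (c + 1)) (c + 1))) hβ0
      simp only [hF, hG]
      linarith
    · have e := mul_le_mul_of_nonneg_left (hS.move_min hV hp _ _ _ (hmem (k - (c + 1)) (c + 1))) hβ0
      simp only [hF, hG]
      linarith
  have b00 : countExp S (F p01) ≤ countExp S (G p01) ∧
      countExp S (G p01) ≤ countExp S (F p01) + 0 * rewardGain m S + β * γ := by
    refine ⟨countExp_mono hS01 fun c _ => ?_, countExp_le_add hS01 fun c _ => ?_⟩
    · have e := mul_le_mul_of_nonneg_left (hV.move_max hp _ _ _ (hmem (k - c) c)) hβ0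
      simp only [hF, hG]
      linarith
    · have e := mul_le_mul_of_nonneg_left (hS.move_max hV hp _ _ _ (hmem (k - c) c)) hβ0
      simp only [hF, hG]
      linarith
  have b01 : countExp S (fun c => G p01 (c + 1)) ≤
        countExp S (F p11) + 1 * rewardGain m S + 0 ∧
      countExp S (F p11) ≤
        countExp S (fun c => G p01 (c + 1)) + (-1) * rewardGain m S + 0 := by
    have e (c : ℕ) (hc : c ≤ S.length) :
        List.replicate (k - (c + 1)) p01 ++ p01 :: (σ ++ List.replicate (c + 1) p11) =
          List.replicate (k - c) p01 ++ (σ ++ p11 :: List.replicate c p11) := by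
      have hc' : k - c = k - (c + 1) + 1 := by omega
      simp [hc', List.replicate_succ' (n := k - (c + 1)), List.replicate_succ (n := c)]
    constructor <;> refine countExp_le_add hS01 fun c hc => ?_ <;>
      simp only [hF, hG, e c hc] <;> linarith
  have b10 : countExp S (fun c => F p01 (c + 1)) ≤
        countExp S (G p11) + 1 * rewardGain m S + β * γ ∧
      countExp S (G p11) ≤
        countExp S (fun c => F p01 (c + 1)) + (-1) * rewardGain m S + β * γ := by
    have e (c : ℕ) (hc : c ≤ S.length) :
        List.replicate (k - (c + 1)) p01 ++ p01 :: (σ ++ List.replicate (c + 1) p11) =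
          List.replicate (k - c) p01 ++ (σ ++ p11 :: List.replicate c p11) := by
      have hc' : k - c = k - (c + 1) + 1 := by omega
      simp [hc', List.replicate_succ' (n := k - (c + 1)), List.replicate_succ (n := c)]
    have e1 (c : ℕ) := mul_le_mul_of_nonneg_left
      (hV.move_max hp _ _ _ (hmem (k - (c + 1)) (c + 1))) hβ0
    have e2 (c : ℕ) := mul_le_mul_of_nonneg_left
      (hS.move_max hV hp _ _ _ (hmem (k - (c + 1)) (c + 1))) hβ0
    have e3 (c : ℕ) := mul_le_mul_of_nonneg_left (hV.move_min hp _ _ _ (hmem (k - c) c)) hβ0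
    have e4 (c : ℕ) := mul_le_mul_of_nonneg_left (hS.move_min hV hp _ _ _ (hmem (k - c) c)) hβ0
    constructor <;> refine countExp_le_add hS01 fun c hc => ?_ <;>
      · have e1 := e1 c
        have e2 := e2 c
        have e3 := e3 c
        have e4 := e4 c
        rw [e c hc] at e1 e2
        simp only [hF, hG]
        linarith
  have hx' : 0 ≤ 1 - x := sub_nonneg.2 hx.2
  have hy' : 0 ≤ 1 - y := sub_nonneg.2 hy.2
  have w11 := mul_nonneg hx.1 hy.1
  have w10 := mul_nonneg hx.1 hy'
  have w01 := mul_nonneg hx' hy.1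
  have w00 := mul_nonneg hx' hy'
  rw [hvalF, hvalG]
  constructor
  · have d11 : countExp S (fun c => F p11 (c + 1)) - countExp S (fun c => G p11 (c + 1)) ≤ γ := by
      linarith
    have d00 : countExp S (F p01) - countExp S (G p01) ≤ γ := by linarith
    have d01 : countExp S (F p11) - countExp S (fun c => G p01 (c + 1)) ≤ γ := by linarith
    have d10 : countExp S (fun c => F p01 (c + 1)) - countExp S (G p11) ≤ γ := by linarith
    linarith [mul_le_mul_of_nonneg_left d11 w11, mul_le_mul_of_nonneg_left d00 w00,
      mul_le_mul_of_nonneg_left d01 w01, mul_le_mul_of_nonneg_left d10 w10]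
  · have d11 : countExp S (fun c => G p11 (c + 1)) - countExp S (fun c => F p11 (c + 1)) ≤ γ := by
      linarith
    have d00 : countExp S (G p01) - countExp S (F p01) ≤ γ := by linarith
    have d01 : countExp S (fun c => G p01 (c + 1)) - countExp S (F p11) ≤ γ := by linarith
    have d10 : countExp S (G p11) - countExp S (fun c => F p01 (c + 1)) ≤ γ := by linarith
    linarith [mul_le_mul_of_nonneg_left d11 w11, mul_le_mul_of_nonneg_left d00 w00,
      mul_le_mul_of_nonneg_left d01 w01, mul_le_mul_of_nonneg_left d10 w10]

theorem swapMono_and_shiftBound_listVal {γ : ℝ} (h0 : 0 ≤ p11) (h1 : p01 ≤ 1) (hp : p11 ≤ p01)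
    (hk : 1 ≤ k) (hβ0 : 0 ≤ β) (hcond : β * γ ≤ Rlow p11 p01 m (k - 1))
    (hγ : Rbar p11 p01 m (k - 1) + β * γ ≤ γ) (hγ0 : 0 ≤ γ) (s : ℕ) :
    SwapMono p01 p11 (listVal p01 p11 β k m s) ∧
      ShiftBound p01 p11 γ (listVal p01 p11 β k m s) := by
  induction s with
  | zero =>
    refine ⟨fun _ _ _ _ _ _ => le_rfl, fun _ _ _ => ?_⟩
    simp only [listVal]
    constructor <;> linarith
  | succ s ih =>
    exact ⟨swapMono_listVal_succ h0 h1 hp hβ0 hcond ih.1 ih.2,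
      shiftBound_listVal_succ h0 h1 hp hk hβ0 hγ hγ0 ih.1 ih.2⟩

end ListVal

theorem ofFn_nextNeg (p01 p11 : ℝ) {N k : ℕ} (hkN : k ≤ N) (ω : Fin N → ℝ) {c : ℕ} (hc : c ≤ k) :
    List.ofFn (nextNeg p01 p11 k ω c) = List.replicate (k - c) p01 ++
      ((((List.ofFn ω).drop k).map (tau p01 p11)).reverse ++ List.replicate c p11) := by
  refine List.ext_getElem (by simp; omega) fun i hi _ => ?_
  simp only [List.length_ofFn] at hi
  simp only [List.getElem_ofFn, nextNeg, List.getElem_append, List.length_replicate,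
    List.getElem_replicate, List.length_reverse, List.length_map, List.length_drop,
    List.length_ofFn, List.getElem_reverse, List.getElem_map, List.getElem_drop]
  split_ifs with ha hb hc' hd
  · rfl
  · congr 3
    omega
  · omega
  · omega
  · rfl

theorem Wneg_eq_listVal (p01 p11 β : ℝ) {N k : ℕ} (m : ℕ) (hkN : k ≤ N) (s : ℕ) (ω : Fin N → ℝ) :
    Wneg p01 p11 β N k m s ω = listVal p01 p11 β k m (s + 1) (List.ofFn ω) := by
  induction s generalizing ω with
  | zero =>
    simp only [Wneg, listVal, mul_zero, add_zero, expReward]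
    exact sum_senseSet_eq_countExp k ω fun c => ((min c m : ℕ) : ℝ)
  | succ s ih =>
    rw [Wneg, listVal, expReward, sum_senseSet_eq_countExp k ω fun c => ((min c m : ℕ) : ℝ),
      sum_senseSet_eq_countExp k ω fun c => Wneg p01 p11 β N k m s (nextNeg p01 p11 k ω c),
      ← one_mul (countExp _ fun c => ((min c m : ℕ) : ℝ)), ← countExp_linear]
    refine countExp_congr fun c hc => ?_
    have hck : c ≤ k := hc.trans (by simp)
    rw [ih, ofFn_nextNeg p01 p11 hkN ω hck, one_mul]

theorem ofFn_cycL {n : ℕ} (ω : Fin (n + 1) → ℝ) :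
    List.ofFn (cycL ω) = List.ofFn (fun i : Fin n => ω i.succ) ++ [ω 0] := by
  refine List.ext_getElem (by simp) fun i hi _ => ?_
  simp only [List.length_ofFn] at hi
  simp only [List.getElem_ofFn, cycL, List.getElem_append, List.length_ofFn,
    List.getElem_singleton]
  split_ifs with ha hb hb
  · rfl
  · omega
  · omega
  · rfl

/-- key inequality L3 for negatively correlated channels:
`γ + W_t(ω_2, ω_3, …, ω_N, ω_1) ≥ W_t(ω_1, …, ω_N)` where `γ = ℛ̄/(1-β)`. -/
theorem Wneg_L3 (p01 p11 β : ℝ) (h0 : p01 ∈ Set.Icc (0 : ℝ) 1)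
    (h1 : p11 ∈ Set.Icc (0 : ℝ) 1) (hp : p11 ≤ p01)
    (N k m T : ℕ) (hm : 1 ≤ m) (hmk : m ≤ k) (hkN : k ≤ N) (hT : 1 ≤ T)
    (hβ0 : 0 ≤ β) (hβ1 : β < 1)
    (hcond : β * (Rlow p11 p01 m (k - 1) + Rbar p11 p01 m (k - 1)) ≤
      Rlow p11 p01 m (k - 1)) :
    ∀ γ : ℝ, γ = Rbar p11 p01 m (k - 1) / (1 - β) →
    ∀ t, 1 ≤ t → t ≤ T → ∀ ω : Fin N → ℝ,
      (∀ i, ω i ∈ Set.Icc p11 p01) → Antitone ω →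
      γ + Wneg p01 p11 β N k m (T - t) (cycL ω) ≥
        Wneg p01 p11 β N k m (T - t) ω := by
  intro γ hγ t _ _ ω hω _
  have hR := Rbar_nonneg h1.1 h0.2 m (k - 1)
  have hβ : 0 < 1 - β := by linarith
  have hγ0 : 0 ≤ γ := hγ ▸ div_nonneg hR hβ.le
  have hγR : γ * (1 - β) = Rbar p11 p01 m (k - 1) := by rw [hγ]; field_simp
  have hcond' : β * γ ≤ Rlow p11 p01 m (k - 1) := by
    rw [hγ, ← mul_div_assoc, div_le_iff₀ hβ]
    linarith
  obtain ⟨n, rfl⟩ : ∃ n, N = n + 1 := ⟨N - 1, by omega⟩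
  have key := ((swapMono_and_shiftBound_listVal h1.1 h0.2 hp (hm.trans hmk) hβ0 hcond'
    (by linarith) hγ0 (T - t + 1)).2 (ω 0) (List.ofFn fun i : Fin n => ω i.succ) (by
      simp only [List.mem_cons, List.mem_ofFn, forall_eq_or_imp, forall_exists_index,
        forall_apply_eq_imp_iff]
      exact ⟨hω 0, fun i => hω i.succ⟩)).1
  rw [Wneg_eq_listVal p01 p11 β m hkN, Wneg_eq_listVal p01 p11 β m hkN, ofFn_cycL,
    List.ofFn_succ]
  linarith
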